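/- arXiv:1802.02277 — 4 statements merged into one kernel-verified Lean document; each statement's English description precedes it below -/
import Mathlib

section
/- Let I be a finite set of players, A = Π_{i ∈ I} A^i a product of finite nonempty action sets, and u^i : A → ℝ utility functions. Assume the game is a potential game with potential Φ : A → ℝ, i.e. for every player i, every α ∈ A and every β ∈ A^i, Φ(β, α^{−i}) − Φ(α) = u^i(β, α^{−i}) − u^i(α), where (β, α^{−i}) denotes α with its i-th coordinate replaced by β. Assume further that every utility is separable: for all α, α' ∈ A with α^i = α'^i one has u^i(α) = u^i(α'). Then for any two profiles α₁, α₂ ∈ A, taking S = {i ∈ I : α₁^i ≠ α₂^i} as the deviating set and R_S(α → α') = Σ_{i ∈ S} (max(u^i(α), u^i(α')) − u^i(α')), one has R_S(α₁ → α₂) − R_S(α₂ → α₁) = Φ(α₁) − Φ(α₂). -/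
/-- In a potential game with separable utilities, switching the coordinates in `s` from `α₂` to
`α₁` changes the potential by the sum of the utility differences of the players in `s`. -/
theorem potential_piecewise_sub {I : Type*} [DecidableEq I] {A : I → Type*}
    {u : ∀ i : I, (∀ j : I, A j) → ℝ} {Φ : (∀ j : I, A j) → ℝ}
    (hpot : ∀ (i : I) (α : ∀ j : I, A j) (β : A i),
      Φ (Function.update α i β) - Φ α = u i (Function.update α i β) - u i α)
    (hsep : ∀ (i : I) (α α' : ∀ j : I, A j), α i = α' i → u i α = u i α')
    (α₁ α₂ : ∀ j : I, A j) (s : Finset I) :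
    Φ (s.piecewise α₁ α₂) - Φ α₂ = ∑ i ∈ s, (u i α₁ - u i α₂) := by
  induction s using Finset.induction_on with
  | empty => simp
  | insert j s hj ih =>
    rw [Finset.sum_insert hj, ← ih, Finset.piecewise_insert]
    have h := hpot j (s.piecewise α₁ α₂) (α₁ j)
    rw [hsep j (Function.update _ j _) α₁ (by simp),
      hsep j (s.piecewise α₁ α₂) α₂ (by simp [hj])] at h
    linarith

/-- Lemma 2: in a potential game with separable utilities, the resistance
difference between a transition and its reverse, with deviating set
`S = {i : α₁ i ≠ α₂ i}`, equals the potential difference. -/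
theorem stmt_2 (I : Type*) [Fintype I] [DecidableEq I] (A : I → Type*)
    [∀ i, Fintype (A i)] [∀ i, Nonempty (A i)] [∀ i, DecidableEq (A i)]
    (u : ∀ i : I, (∀ j : I, A j) → ℝ) (Φ : (∀ j : I, A j) → ℝ)
    (hpot : ∀ (i : I) (α : ∀ j : I, A j) (β : A i),
      Φ (Function.update α i β) - Φ α = u i (Function.update α i β) - u i α)
    (hsep : ∀ (i : I) (α α' : ∀ j : I, A j), α i = α' i → u i α = u i α')
    (α₁ α₂ : ∀ j : I, A j) :
    (∑ i ∈ Finset.univ.filter (fun i : I => α₁ i ≠ α₂ i),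
        (max (u i α₁) (u i α₂) - u i α₂)) -
      (∑ i ∈ Finset.univ.filter (fun i : I => α₁ i ≠ α₂ i),
        (max (u i α₂) (u i α₁) - u i α₁)) = Φ α₁ - Φ α₂ := by
  have hpw : (Finset.univ.filter fun i : I => α₁ i ≠ α₂ i).piecewise α₁ α₂ = α₁ := by
    ext i
    by_cases h : α₁ i = α₂ i <;> simp [Finset.piecewise, h]
  have hsum := potential_piecewise_sub hpot hsep α₁ α₂
    (Finset.univ.filter fun i : I => α₁ i ≠ α₂ i)
  rw [hpw] at hsum
  rw [hsum, ← Finset.sum_sub_distrib]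
  refine Finset.sum_congr rfl fun i _ => ?_
  rw [max_comm (u i α₂)]
  ring
end

section
/- Let I be a finite set of players, A = Π_{i ∈ I} A^i, u^i : A → ℝ utility functions, and Φ : A → ℝ a potential function, i.e. for every player i, every α ∈ A and every β ∈ A^i, Φ(β, α^{−i}) − Φ(α) = u^i(β, α^{−i}) − u^i(α). Let Ω = (α₀, α₁, …, α_m) be a path of action profiles such that each consecutive pair α_k, α_{k+1} differs in exactly one coordinate, say that of player i_k. Define the resistance of each edge as R(α_k → α_{k+1}) = max(u^{i_k}(α_k), u^{i_k}(α_{k+1})) − u^{i_k}(α_{k+1}), the resistance of the path R(Ω) = Σ_{k=0}^{m−1} R(α_k → α_{k+1}), and the resistance of the reverse path R(Ω^R) = Σ_{k=0}^{m−1} R(α_{k+1} → α_k). Then R(Ω) − R(Ω^R) = Φ(α₀) − Φ(α_m). -/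
/-- Telescoping resistance identity along a path of single-deviator
transitions in a potential game: `R(Ω) − R(Ω^R) = Φ(α₀) − Φ(α_m)`. -/
theorem stmt_3 (I : Type*) [Fintype I] [DecidableEq I] (A : I → Type*)
    (u : ∀ i : I, (∀ j : I, A j) → ℝ) (Φ : (∀ j : I, A j) → ℝ)
    (hpot : ∀ (i : I) (α : ∀ j : I, A j) (β : A i),
      Φ (Function.update α i β) - Φ α = u i (Function.update α i β) - u i α)
    (m : ℕ) (α : ℕ → ∀ j : I, A j) (ι : ℕ → I)
    (hstep : ∀ k < m, α (k + 1) = Function.update (α k) (ι k) (α (k + 1) (ι k)))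
    (hdev : ∀ k < m, α k (ι k) ≠ α (k + 1) (ι k)) :
    (∑ k ∈ Finset.range m,
        (max (u (ι k) (α k)) (u (ι k) (α (k + 1))) - u (ι k) (α (k + 1)))) -
      (∑ k ∈ Finset.range m,
        (max (u (ι k) (α (k + 1))) (u (ι k) (α k)) - u (ι k) (α k))) =
      Φ (α 0) - Φ (α m) := by
  rw [← Finset.sum_sub_distrib, ← Finset.sum_range_sub' (fun k => Φ (α k))]
  refine Finset.sum_congr rfl fun k hk => ?_
  have h := hpot (ι k) (α k) (α (k + 1) (ι k))
  rw [← hstep k (Finset.mem_range.mp hk)] at h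
  rw [max_comm (u (ι k) (α (k + 1)))]
  linarith
end

section
/- Let 0 < μ < 1 and u ∈ ℝ, and let P, Q : ℕ → ℝ satisfy the double-aggregation recursions P(k+1) = P(k) + μ(u − P(k)) and Q(k+1) = Q(k) + μ(P(k) − Q(k)) for all k ≥ n. Then for every m ≥ 0, Q(n+m) = m(1−μ)^{m−1} Q(n+1) − (m−1)(1−μ)^m Q(n) + ((m−1)(1−μ)^m − m(1−μ)^{m−1} + 1) · u. -/
/-- Closed form of the second-order (double-aggregation) recursion
(Proposition 2, eq. (20)). -/
theorem stmt_5 (μ u : ℝ) (hμ0 : 0 < μ) (hμ1 : μ < 1) (n : ℕ) (P Q : ℕ → ℝ)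
    (hP : ∀ k ≥ n, P (k + 1) = P k + μ * (u - P k))
    (hQ : ∀ k ≥ n, Q (k + 1) = Q k + μ * (P k - Q k)) :
    ∀ m : ℕ, Q (n + m) =
      (m : ℝ) * (1 - μ) ^ (m - 1) * Q (n + 1)
        - ((m : ℝ) - 1) * (1 - μ) ^ m * Q n
        + (((m : ℝ) - 1) * (1 - μ) ^ m - (m : ℝ) * (1 - μ) ^ (m - 1) + 1) * u := by
  have hPm : ∀ m : ℕ, P (n + m) = u + (1 - μ) ^ m * (P n - u) := by
    intro m
    induction m with
    | zero => simp
    | succ m ih =>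
      rw [← add_assoc, hP (n + m) (Nat.le_add_right n m), ih]
      ring
  have hQ₁ : Q (n + 1) = Q n + μ * (P n - Q n) := hQ n le_rfl
  intro m
  cases m with
  | zero => simp
  | succ m =>
    induction m with
    | zero => simp
    | succ m ih =>
      rw [← add_assoc, hQ (n + (m + 1)) (Nat.le_add_right n _), ih, hPm, hQ₁]
      simp only [Nat.add_sub_cancel]
      push_cast
      ring
end

section
/- Let I be a finite set of players and A = Π_{i ∈ I} A^i a product of finite nonempty action sets, with utilities u^i : A → ℝ. Assume there is a potential function Φ : A → ℝ such that for every player i, every α ∈ A and every β ∈ A^i, Φ(β, α^{−i}) − Φ(α) = u^i(β, α^{−i}) − u^i(α). Then every improvement path is finite: there is no infinite sequence (α_k)_{k ∈ ℕ} of action profiles such that for each k there exists a player i_k with α_{k+1} = (β_k, α_k^{−i_k}) for some β_k ∈ A^{i_k} and u^{i_k}(α_{k+1}) > u^{i_k}(α_k). -/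
/-- Theorem 1 (finite improvement property): a finite potential game admits
no infinite improvement path. -/
theorem stmt_14 (I : Type*) [Fintype I] [DecidableEq I] (A : I → Type*)
    [∀ i, Fintype (A i)] [∀ i, Nonempty (A i)]
    (u : ∀ i : I, (∀ j : I, A j) → ℝ) (Φ : (∀ j : I, A j) → ℝ)
    (hpot : ∀ (i : I) (α : ∀ j : I, A j) (β : A i),
      Φ (Function.update α i β) - Φ α = u i (Function.update α i β) - u i α) :
    ¬ ∃ α : ℕ → ∀ j : I, A j, ∀ k : ℕ, ∃ (i : I) (β : A i),
        α (k + 1) = Function.update (α k) i β ∧ u i (α (k + 1)) > u i (α k) := by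
  rintro ⟨α, hα⟩
  have hmono : StrictMono fun k => Φ (α k) := by
    refine strictMono_nat_of_lt_succ fun k => ?_
    obtain ⟨i, β, hk, hlt⟩ := hα k
    have h := hpot i (α k) β
    rw [← hk] at h
    linarith
  exact not_injective_infinite_finite α (Function.Injective.of_comp (f := Φ) hmono.injective)
end
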